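/- Let V be a vector space over a field K of countable infinite dimension such that every linear subspace of V is closed (equivalently work purely algebraically: density means equality). Suppose T : V → V is a linear map for which there exists a finite-dimensional subspace L ⊆ V with span{Tᵏ(L) : k ∈ ℕ} = V. Then there exist k ≥ 1 and a linear subspace Y of V of finite codimension such that T(Y) ⊆ Y and T|_Y is linearly conjugate to M^k on K[X], where Mp(z) = z·p(z). -/

import Mathlib

open Polynomial

lemma exists_shiftEquiv (K : Type*) [Field K] (n : ℕ) [NeZero n] :
    ∃ J : K[X] ≃ₗ[K] (Fin n →₀ K[X]), ∀ p : K[X], J (X ^ n * p) = (X : K[X]) • J p := by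
  let B : Module.Basis (ℕ × Fin n) K (Fin n →₀ K[X]) :=
    (Polynomial.basisMonomials K).smulTower (Finsupp.basisSingleOne (R := K[X]) (ι := Fin n))
  let C : Module.Basis ℕ K (Fin n →₀ K[X]) := B.reindex (Nat.divModEquiv n).symm
  have hJ : ∀ m : ℕ, ((Polynomial.basisMonomials K).equiv C (Equiv.refl ℕ)) (monomial m 1) = C m := by
    intro m
    have := (Polynomial.basisMonomials K).equiv_apply m C (Equiv.refl ℕ)
    simpa using this
  have hC : ∀ m : ℕ, C m = Finsupp.single (Fin.ofNat n m) (monomial (m / n) (1 : K)) := by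
    intro m
    simp [C, B, Module.Basis.smulTower_apply, Nat.divModEquiv]
  refine ⟨(Polynomial.basisMonomials K).equiv C (Equiv.refl ℕ), fun p => ?_⟩
  induction p using Polynomial.induction_on' with
  | add p q hp hq => rw [mul_add, map_add, hp, hq, map_add, smul_add]
  | monomial m a =>
    have h1 : (monomial m a : K[X]) = a • monomial m 1 := by simp [smul_monomial]
    have h2 : (X : K[X]) ^ n * monomial m 1 = monomial (m + n) 1 := by
      rw [X_pow_eq_monomial, monomial_mul_monomial, add_comm, one_mul]
    rw [h1, mul_smul_comm, h2, map_smul, map_smul, hJ, hJ, smul_comm, hC, hC]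
    congr 1
    have h3 : Fin.ofNat n (m + n) = Fin.ofNat n m := by
      ext; simp
    rw [h3, Nat.add_div_right _ (NeZero.pos n), Finsupp.smul_single, smul_eq_mul, X_mul_monomial]

lemma finite_aeval {K : Type*} [Field K] {V : Type*} [AddCommGroup V] [Module K V]
    (T : Module.End K V) (L : Submodule K V) (hL : Module.Finite K L)
    (hmc : Submodule.span K (⋃ n : ℕ, (T ^ n) '' (L : Set V)) = ⊤) :
    Module.Finite K[X] (Module.AEval' T) := by
  obtain ⟨s, hs⟩ := Module.Finite.iff_fg.1 hL
  let N : Submodule K[X] (Module.AEval' T) := Submodule.span K[X] (Module.AEval'.of T '' (s : Set V))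
  have hN : ∀ v : V, Module.AEval'.of T v ∈ N := by
    let N' : Submodule K V := (N.restrictScalars K).comap (Module.AEval'.of T).toLinearMap
    have hLN : L ≤ N' := by
      rw [← hs, Submodule.span_le]
      intro x hx
      have h : Module.AEval'.of T x ∈ N := Submodule.subset_span ⟨x, hx, rfl⟩
      exact h
    have hT : ∀ v ∈ N', T v ∈ N' := by
      intro v hv
      have h : (X : K[X]) • Module.AEval'.of T v ∈ N := N.smul_mem _ hv
      rwa [Module.AEval'.X_smul_of] at h
    have htop : N' = ⊤ := by
      rw [eq_top_iff, ← hmc, Submodule.span_le]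
      refine Set.iUnion_subset fun n => ?_
      rintro _ ⟨x, hx, rfl⟩
      induction n with
      | zero => exact hLN hx
      | succ n ih =>
        rw [pow_succ']
        exact hT _ ih
    intro v
    have : v ∈ N' := htop ▸ Submodule.mem_top
    exact this
  refine ⟨⟨(s.finite_toSet.image (Module.AEval'.of T)).toFinset, ?_⟩⟩
  rw [Set.Finite.coe_toFinset, eq_top_iff]
  intro x _
  have := hN ((Module.AEval'.of T).symm x)
  simpa using this

lemma stmt_aux {K : Type*} [Field K] {V : Type*} [AddCommGroup V] [Module K V]
    (hdim : Module.rank K V = Cardinal.aleph0) (T : Module.End K V)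
    {D : Type*} [AddCommMonoid D] [Module K D] [Module K[X] D] [Module.Finite K D] (n : ℕ)
    (F : V ≃ₗ[K] (Fin n →₀ K[X]) × D) (hF : ∀ v, F (T v) = (X : K[X]) • F v) :
    ∃ (k : ℕ), 1 ≤ k ∧ ∃ Y : Submodule K V,
      Module.Finite K (V ⧸ Y) ∧ (∀ y ∈ Y, T y ∈ Y) ∧
      ∃ J : K[X] ≃ₗ[K] Y,
        ∀ p : K[X], T (J p : V) = (J ((X : K[X]) ^ k * p) : V) := by
  letI : AddCommGroup D := Module.addCommMonoidToAddCommGroup K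
  let φ := (LinearMap.snd K (Fin n →₀ K[X]) D) ∘ₗ F.toLinearMap
  have hn : n ≠ 0 := by
    rintro rfl
    have hinj : Function.Injective φ := by
      intro a b hab
      apply F.injective
      exact Prod.ext (Subsingleton.elim _ _) hab
    have : Module.Finite K V := Module.Finite.of_injective φ hinj
    have := Module.rank_lt_aleph0 K V
    exact absurd hdim this.ne
  have : NeZero n := ⟨hn⟩
  let g : (Fin n →₀ K[X]) →ₗ[K] V := F.symm.toLinearMap ∘ₗ LinearMap.inl K _ _
  have hg : ∀ f, F (g f) = (f, 0) := fun f => by simp [g]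
  have hginj : Function.Injective g := by
    intro a b hab
    have := congrArg F hab
    rw [hg, hg] at this
    exact (Prod.mk.inj this).1
  have hTg : ∀ f, T (g f) = g ((X : K[X]) • f) := by
    intro f
    apply F.injective
    rw [hF, hg, hg, Prod.smul_mk, smul_zero]
  have hker : LinearMap.ker φ = LinearMap.range g := by
    ext v
    constructor
    · intro hv
      refine ⟨(F v).1, F.injective ?_⟩
      rw [hg]
      exact Prod.ext rfl (LinearMap.mem_ker.1 hv).symm
    · rintro ⟨f, rfl⟩
      change (F (g f)).2 = 0
      rw [hg]
  obtain ⟨J, hJ⟩ := exists_shiftEquiv K n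
  refine ⟨n, Nat.one_le_iff_ne_zero.2 hn, LinearMap.range g, ?_, ?_,
    J.trans (LinearEquiv.ofInjective g hginj), ?_⟩
  · rw [← hker]
    exact Module.Finite.equiv φ.quotKerEquivRange.symm
  · rintro _ ⟨f, rfl⟩
    exact ⟨_, (hTg f).symm⟩
  · intro q
    simp only [LinearEquiv.trans_apply, LinearEquiv.ofInjective_apply, hJ, hTg]

/-- A multicyclic linear operator on a vector space of countably infinite
dimension admits an invariant subspace Y of finite codimension on which it is
linearly conjugate to M^k for some k ≥ 1. -/
theorem stmt_5 {K : Type*} [Field K] {V : Type*} [AddCommGroup V] [Module K V]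
    (hdim : Module.rank K V = Cardinal.aleph0)
    (T : Module.End K V) (L : Submodule K V) (hL : Module.Finite K L)
    (hmc : Submodule.span K (⋃ n : ℕ, (T ^ n) '' (L : Set V)) = ⊤) :
    ∃ (k : ℕ), 1 ≤ k ∧ ∃ Y : Submodule K V,
      Module.Finite K (V ⧸ Y) ∧ (∀ y ∈ Y, T y ∈ Y) ∧
      ∃ J : K[X] ≃ₗ[K] Y,
        ∀ p : K[X], T (J p : V) = (J ((X : K[X]) ^ k * p) : V) := by
  classical
  have hfin := finite_aeval T L hL hmc
  obtain ⟨n, ι, hι, p, hp, e, ⟨E⟩⟩ := Module.equiv_free_prod_directSum (R := K[X]) (M := Module.AEval' T)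
  have hD : ∀ i, Module.Finite K (K[X] ⧸ Submodule.span K[X] {p i ^ e i}) := by
    intro i
    have h0 : p i ^ e i ≠ 0 := pow_ne_zero _ (hp i).ne_zero
    exact (AdjoinRoot.powerBasis h0).finite
  have hDD : Module.Finite K (DirectSum ι fun i => K[X] ⧸ Submodule.span K[X] {p i ^ e i}) :=
    inferInstanceAs (Module.Finite K (Π₀ i, K[X] ⧸ Submodule.span K[X] {p i ^ e i}))
  let F : V ≃ₗ[K] (Fin n →₀ K[X]) × (DirectSum ι fun i => K[X] ⧸ Submodule.span K[X] {p i ^ e i}) :=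
    (Module.AEval'.of T).trans (E.restrictScalars K)
  have hF : ∀ v, F (T v) = (X : K[X]) • F v := by
    intro v
    change E (Module.AEval'.of T (T v)) = (X : K[X]) • E (Module.AEval'.of T v)
    rw [← Module.AEval'.X_smul_of, map_smul]
  exact stmt_aux hdim T n F hF
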